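/- Corollary for uniformly separated knots with full multiplicity: Let r ∈ ℕ₀, μ ∈ ℕ, z_0 < z_1 < ... < z_μ with z_{j+1} - z_j ≥ λ(z_μ - z_0) for all j, 0 < λ ≤ 1, I = [z_0, z_μ], m = (r+1)(μ+1). If f ∈ C^{(r)}(I), let L be the Hermite polynomial of degree ≤ m-1 = rμ+μ+r with L^{(j)}(z_ν) = f^{(j)}(z_ν) for all 0 ≤ ν ≤ μ, 0 ≤ j ≤ r. Then for all x ∈ I: |f(x) - L(x)| ≤ C(m,λ) · (dist(x,Z))^{r+1} · ∫_{dist(x,Z)}^{2|I|} ω_{m-r}(f^{(r)}, t; I)/t² dt, where dist(x,Z) = min_ν |x - z_ν| and |I| = z_μ - z_0. -/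

import Mathlib

open scoped BigOperators

open Classical in
/-- Divided difference with possibly repeated knots, via derivative data `F`
(`F j` is the `j`-th derivative). -/
noncomputable def divDiff (F : ℕ → ℝ → ℝ) : List ℝ → ℝ
  | [] => 0
  | [x] => F 0 x
  | x :: y :: l =>
      if h : ∀ z ∈ y :: l, z = x then
        F ((y :: l).length) x / Nat.factorial ((y :: l).length)
      else
        (divDiff F (y :: l) -
          divDiff F (x :: (y :: l).eraseIdx ((y :: l).findIdx (fun z => z ≠ x)))) /
          ((y :: l).getD ((y :: l).findIdx (fun z => z ≠ x)) 0 - x)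
termination_by l => l.length
decreasing_by
  · simp
  · push_neg at h
    obtain ⟨z, hz, hzx⟩ := h
    have hlt : (y :: l).findIdx (fun z => decide (z ≠ x)) < (y :: l).length :=
      List.findIdx_lt_length_of_exists ⟨z, hz, by simpa using hzx⟩
    simp only [List.length_cons, List.length_eraseIdx] at *
    rw [if_pos hlt]; omega

/-- Newton form of the Hermite interpolation polynomial at the knots `xs`. -/
noncomputable def newtonSum (F : ℕ → ℝ → ℝ) (xs : List ℝ) (t : ℝ) : ℝ :=
  ∑ j ∈ Finset.range xs.length,
    divDiff F (xs.take (j + 1)) * ∏ i ∈ Finset.range j, (t - xs.getD i 0)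

/-- The `k`-th symmetric difference of `g`, set to `0` when the relevant points
leave `[a,b]`. -/
noncomputable def kSymmDiff (k : ℕ) (g : ℝ → ℝ) (u x a b : ℝ) : ℝ :=
  if a ≤ x - (k / 2 : ℝ) * u ∧ x + (k / 2 : ℝ) * u ≤ b then
    ∑ i ∈ Finset.range (k + 1), (-1 : ℝ) ^ i * (k.choose i) * g (x + ((k : ℝ) / 2 - i) * u)
  else 0

/-- The `k`-th modulus of smoothness of `g` on `[a,b]`. -/
noncomputable def smoothOmega (k : ℕ) (g : ℝ → ℝ) (t a b : ℝ) : ℝ :=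
  sSup {v : ℝ | ∃ u x : ℝ, 0 < u ∧ u ≤ t ∧ v = |kSymmDiff k g u x a b|}

/-- First modulus of continuity of `g` on `[a,b]`. -/
noncomputable def omega1 (g : ℝ → ℝ) (t a b : ℝ) : ℝ :=
  sSup {v : ℝ | ∃ x y : ℝ, x ∈ Set.Icc a b ∧ y ∈ Set.Icc a b ∧ |x - y| ≤ t ∧ v = |g x - g y|}

/-- Sup norm on `[a,b]`. -/
noncomputable def supNorm (g : ℝ → ℝ) (a b : ℝ) : ℝ :=
  sSup {v : ℝ | ∃ x ∈ Set.Icc a b, v = |g x|}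

/-- The knots extended by `x₋₁ = x₀ - (xₘ - x₀)` and `x_{m+1} = xₘ + (xₘ - x₀)`. -/
noncomputable def xExt (m : ℕ) (x : ℕ → ℝ) : ℤ → ℝ := fun i =>
  if i < 0 then x 0 - (x m - x 0) else if (m : ℤ) < i then x m + (x m - x 0) else x i.toNat

/-- `d(p,q) = min (x_{q+1} - x_p) (x_q - x_{p-1})`. -/
noncomputable def dpq (m : ℕ) (x : ℕ → ℝ) (p q : ℕ) : ℝ :=
  min (xExt m x ((q : ℤ) + 1) - x p) (x q - xExt m x ((p : ℤ) - 1))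

/-- `Λ_{p,q,r}(x_0,…,x_m; φ)`. -/
noncomputable def Lam (m r : ℕ) (x : ℕ → ℝ) (φ : ℝ → ℝ) (p q : ℕ) : ℝ :=
  (∫ u in Set.Ioc (x q - x p) (dpq m x p q), u ^ ((p : ℤ) + r - q - 1) * φ u) /
    ((∏ i ∈ Finset.range p, (x q - x i)) * ∏ i ∈ Finset.Ioc q m, (x i - x p))

/-- `Λ_r(x_0,…,x_m; φ) = max over admissible (p,q) of Λ_{p,q,r}`. -/
noncomputable def LamMax (m r : ℕ) (x : ℕ → ℝ) (φ : ℝ → ℝ) : ℝ :=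
  sSup {v : ℝ | ∃ p q : ℕ, q ≤ m ∧ p + r + 1 ≤ q ∧ v = Lam m r x φ p q}

lemma fwdDiff_iter_eq_real_sum (g : ℝ → ℝ) (u : ℝ) (k : ℕ) (x : ℝ) :
    (fwdDiff u)^[k] g x =
      ∑ i ∈ Finset.range (k + 1), (-1 : ℝ) ^ (k - i) * (k.choose i) * g (x + i * u) := by
  rw [fwdDiff_iter_eq_sum_shift]
  refine Finset.sum_congr rfl fun i _ => ?_
  simp [zsmul_eq_mul]

lemma fwdDiff_iter_neg (g : ℝ → ℝ) (u : ℝ) (k : ℕ) (x : ℝ) :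
    (fwdDiff (-u))^[k] g (x + k * u) = (-1) ^ k * (fwdDiff u)^[k] g x := by
  rw [fwdDiff_iter_eq_real_sum, fwdDiff_iter_eq_real_sum, ← Finset.sum_flip, Finset.mul_sum]
  refine Finset.sum_congr rfl fun i hi => ?_
  have hi' : i ≤ k := Nat.lt_succ_iff.mp (Finset.mem_range.mp hi)
  rw [Nat.choose_symm hi', Nat.sub_sub_self hi', Nat.cast_sub hi']
  have h1 : x + k * u + ((k : ℝ) - i) * -u = x + i * u := by ring
  have h2 : (-1 : ℝ) ^ i = (-1) ^ k * (-1) ^ (k - i) := by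
    rw [← pow_add, show k + (k - i) = i + 2 * (k - i) by omega, pow_add, pow_mul]
    simp
  rw [h1, h2]
  ring

lemma abs_fwdDiff_iter_neg (g : ℝ → ℝ) (u : ℝ) (k : ℕ) (x : ℝ) :
    |(fwdDiff (-u))^[k] g (x + k * u)| = |(fwdDiff u)^[k] g x| := by
  rw [fwdDiff_iter_neg, abs_mul, abs_pow, abs_neg, abs_one, one_pow, one_mul]

lemma fwdDiff_iter_polynomial_eq_zero (P : Polynomial ℝ) {k : ℕ} (hP : P.natDegree < k)
    (u x : ℝ) : (fwdDiff u)^[k] (fun y => P.eval y) x = 0 := by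
  set Q := P.comp (Polynomial.C u * Polynomial.X + Polynomial.C x) with hQ
  have hdeg : Q.natDegree < k := by
    refine lt_of_le_of_lt Polynomial.natDegree_comp_le ?_
    calc P.natDegree * _ ≤ P.natDegree * 1 :=
          Nat.mul_le_mul_left _ Polynomial.natDegree_linear_le
      _ < k := by simpa using hP
  have h := congrFun (Polynomial.fwdDiff_iter_eq_zero_of_degree_lt hdeg) 0
  rw [fwdDiff_iter_eq_real_sum] at h ⊢
  rw [Pi.zero_apply] at h
  rw [← h]
  refine Finset.sum_congr rfl fun i _ => ?_
  simp only [hQ, Polynomial.eval_comp, Polynomial.eval_add, Polynomial.eval_mul,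
    Polynomial.eval_C, Polynomial.eval_X]
  rw [show u * (0 + (i : ℝ) * 1) + x = x + i * u by ring]

lemma fwdDiff_iter_sub (f g : ℝ → ℝ) (u : ℝ) (k : ℕ) (x : ℝ) :
    (fwdDiff u)^[k] (fun y => f y - g y) x = (fwdDiff u)^[k] f x - (fwdDiff u)^[k] g x := by
  simp only [fwdDiff_iter_eq_real_sum, ← Finset.sum_sub_distrib, mul_sub]

lemma fwdDiff_iter_two_mul (g : ℝ → ℝ) (u : ℝ) (k : ℕ) (x : ℝ) :
    (fwdDiff (2 * u))^[k] g x =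
      ∑ l ∈ Finset.range (k + 1), (k.choose l : ℝ) * (fwdDiff u)^[k] g (x + l * u) := by
  induction k generalizing g x with
  | zero => simp
  | succ k ih =>
    have h2 : fwdDiff (2 * u) g = fun y => fwdDiff u g y + fwdDiff u g (y + u) := by
      funext y
      simp only [fwdDiff]
      rw [show y + 2 * u = y + u + u by ring]
      ring
    have hadd : ∀ y, (fwdDiff u)^[k] (fwdDiff (2 * u) g) y =
        (fwdDiff u)^[k + 1] g y + (fwdDiff u)^[k + 1] g (y + u) := by
      intro y
      rw [h2, Function.iterate_succ_apply, ← fwdDiff_iter_comp_add]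
      simp only [fwdDiff_iter_eq_real_sum, ← Finset.sum_add_distrib, mul_add]
    rw [Function.iterate_succ_apply, ih]
    simp only [hadd, mul_add, Finset.sum_add_distrib]
    rw [Finset.sum_range_succ' _ (k + 1)]
    simp only [Nat.choose_succ_succ, Nat.cast_add, add_mul, Finset.sum_add_distrib]
    rw [Finset.sum_range_succ (fun i => (k.choose (i + 1) : ℝ) * _) k,
      Finset.sum_range_succ' (fun i => (k.choose i : ℝ) * (fwdDiff u)^[k + 1] g (x + i * u)) k]
    simp [add_mul, add_assoc]
    ring

lemma fwdDiff_iter_shift_sub (g : ℝ → ℝ) (u : ℝ) (k l : ℕ) (x : ℝ) :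
    (fwdDiff u)^[k] g (x + l * u) - (fwdDiff u)^[k] g x =
      ∑ p ∈ Finset.range l, (fwdDiff u)^[k + 1] g (x + p * u) := by
  induction l with
  | zero => simp
  | succ l ih =>
    rw [Finset.sum_range_succ, ← ih, Function.iterate_succ_apply']
    simp only [fwdDiff]
    push_cast
    rw [show x + (l + 1 : ℝ) * u = x + l * u + u by ring]
    ring

lemma abs_fwdDiff_iter_le_doubling (g : ℝ → ℝ) (u x W : ℝ) (k : ℕ)
    (hW : ∀ p < k, |(fwdDiff u)^[k + 1] g (x + p * u)| ≤ W) :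
    2 ^ k * |(fwdDiff u)^[k] g x| ≤ |(fwdDiff (2 * u))^[k] g x| + 2 ^ k * k * W := by
  have key : (fwdDiff (2 * u))^[k] g x - 2 ^ k * (fwdDiff u)^[k] g x =
      ∑ l ∈ Finset.range (k + 1),
        (k.choose l : ℝ) * ((fwdDiff u)^[k] g (x + l * u) - (fwdDiff u)^[k] g x) := by
    simp only [mul_sub, Finset.sum_sub_distrib]
    rw [← fwdDiff_iter_two_mul, ← Finset.sum_mul]
    congr 2
    exact_mod_cast (Nat.sum_range_choose k).symm
  have hterm : ∀ l ∈ Finset.range (k + 1),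
      |(k.choose l : ℝ) * ((fwdDiff u)^[k] g (x + l * u) - (fwdDiff u)^[k] g x)| ≤
        (k.choose l : ℝ) * (k * W) := by
    intro l hl
    have hl' : l ≤ k := Nat.lt_succ_iff.mp (Finset.mem_range.mp hl)
    rw [abs_mul, Nat.abs_cast]
    refine mul_le_mul_of_nonneg_left ?_ (Nat.cast_nonneg _)
    rcases Nat.eq_zero_or_pos k with rfl | hk
    · obtain rfl : l = 0 := by omega
      simp
    have hW0 : 0 ≤ W := (abs_nonneg _).trans (hW 0 hk)
    rw [fwdDiff_iter_shift_sub]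
    calc _ ≤ ∑ p ∈ Finset.range l, |(fwdDiff u)^[k + 1] g (x + p * u)| :=
          Finset.abs_sum_le_sum_abs _ _
      _ ≤ ∑ _p ∈ Finset.range l, W := Finset.sum_le_sum fun p hp =>
          hW p ((Finset.mem_range.mp hp).trans_le hl')
      _ = l * W := by simp
      _ ≤ k * W := by gcongr
  have hsum : |(fwdDiff (2 * u))^[k] g x - 2 ^ k * (fwdDiff u)^[k] g x| ≤ 2 ^ k * k * W := by
    rw [key]
    refine (Finset.abs_sum_le_sum_abs _ _).trans ((Finset.sum_le_sum hterm).trans_eq ?_)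
    rw [← Finset.sum_mul, mul_assoc]
    congr 1
    exact_mod_cast Nat.sum_range_choose k
  have h3 : |2 ^ k * (fwdDiff u)^[k] g x| = 2 ^ k * |(fwdDiff u)^[k] g x| := by
    rw [abs_mul, abs_of_pos (by positivity : (0 : ℝ) < 2 ^ k)]
  have h4 := abs_sub_abs_le_abs_sub (2 ^ k * (fwdDiff u)^[k] g x) ((fwdDiff (2 * u))^[k] g x)
  rw [abs_sub_comm] at h4
  linarith

lemma fwdDiff_iter_points_mem {a b x u : ℝ} {k : ℕ} (hx : x ∈ Set.Icc a b)
    (hxk : x + k * u ∈ Set.Icc a b) {i : ℕ} (hi : i ≤ k) : x + i * u ∈ Set.Icc a b := by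
  have hi' : (i : ℝ) ≤ k := by exact_mod_cast hi
  have hi0 : (0 : ℝ) ≤ i := i.cast_nonneg
  obtain ⟨h1, h2⟩ := hx
  obtain ⟨h3, h4⟩ := hxk
  rcases le_total 0 u with hu | hu
  · constructor <;> nlinarith
  · constructor <;> nlinarith

lemma abs_fwdDiff_iter_le_of_bound {g : ℝ → ℝ} {a b M u x : ℝ} {k : ℕ}
    (hM : ∀ y ∈ Set.Icc a b, |g y| ≤ M) (hx : x ∈ Set.Icc a b)
    (hxk : x + k * u ∈ Set.Icc a b) : |(fwdDiff u)^[k] g x| ≤ 2 ^ k * M := by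
  rw [fwdDiff_iter_eq_real_sum]
  refine (Finset.abs_sum_le_sum_abs _ _).trans ?_
  have : ∀ i ∈ Finset.range (k + 1),
      |(-1 : ℝ) ^ (k - i) * (k.choose i) * g (x + i * u)| ≤ (k.choose i) * M := by
    intro i hi
    rw [abs_mul, abs_mul, abs_pow, abs_neg, abs_one, one_pow, one_mul, Nat.abs_cast]
    exact mul_le_mul_of_nonneg_left
      (hM _ (fwdDiff_iter_points_mem hx hxk (Nat.lt_succ_iff.mp (Finset.mem_range.mp hi))))
      (Nat.cast_nonneg _)
  refine (Finset.sum_le_sum this).trans_eq ?_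
  rw [← Finset.sum_mul]
  congr 1
  exact_mod_cast Nat.sum_range_choose k

lemma kSymmDiff_add_half (k : ℕ) (g : ℝ → ℝ) (u x a b : ℝ) :
    kSymmDiff k g u (x + (k / 2 : ℝ) * u) a b =
      if a ≤ x ∧ x + k * u ≤ b then (fwdDiff u)^[k] g x else 0 := by
  rw [kSymmDiff, fwdDiff_iter_eq_real_sum, ← Finset.sum_flip]
  have h1 : x + (k / 2 : ℝ) * u - (k / 2 : ℝ) * u = x := by ring
  have h2 : x + (k / 2 : ℝ) * u + (k / 2 : ℝ) * u = x + k * u := by ring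
  rw [h1, h2]
  congr 1
  refine Finset.sum_congr rfl fun i hi => ?_
  have hi' : i ≤ k := Nat.lt_succ_iff.mp (Finset.mem_range.mp hi)
  rw [Nat.choose_symm hi', Nat.cast_sub hi']
  congr 2
  ring

lemma smoothOmega_nonneg (k : ℕ) (g : ℝ → ℝ) (t a b : ℝ) : 0 ≤ smoothOmega k g t a b := by
  refine Real.sSup_nonneg ?_
  rintro v ⟨u, x, -, -, rfl⟩
  exact abs_nonneg _

lemma smoothOmega_le {k : ℕ} {g : ℝ → ℝ} {t a b B : ℝ} (hB : 0 ≤ B)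
    (h : ∀ u x, 0 < u → u ≤ t → a ≤ x → x + k * u ≤ b → |(fwdDiff u)^[k] g x| ≤ B) :
    smoothOmega k g t a b ≤ B := by
  refine Real.sSup_le ?_ hB
  rintro v ⟨u, x, hu, hut, rfl⟩
  have := kSymmDiff_add_half k g u (x - (k / 2 : ℝ) * u) a b
  rw [sub_add_cancel] at this
  rw [this]
  split_ifs with hc
  · exact h u _ hu hut hc.1 hc.2
  · simpa using hB

lemma bddAbove_smoothOmega_set {k : ℕ} {g : ℝ → ℝ} {t a b M : ℝ}
    (hM : ∀ y ∈ Set.Icc a b, |g y| ≤ M) :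
    BddAbove {v : ℝ | ∃ u x : ℝ, 0 < u ∧ u ≤ t ∧ v = |kSymmDiff k g u x a b|} := by
  refine ⟨2 ^ k * |M|, ?_⟩
  rintro v ⟨u, x, hu, hut, rfl⟩
  have := kSymmDiff_add_half k g u (x - (k / 2 : ℝ) * u) a b
  rw [sub_add_cancel] at this
  rw [this]
  split_ifs with hc
  · have hk : 0 ≤ k * u := by positivity
    exact abs_fwdDiff_iter_le_of_bound (fun y hy => (hM y hy).trans (le_abs_self M))
      ⟨hc.1, by linarith [hc.2]⟩ ⟨by linarith [hc.1], hc.2⟩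
  · simp only [abs_zero]
    positivity

lemma abs_fwdDiff_iter_le_smoothOmega {k : ℕ} {g : ℝ → ℝ} {t a b M u x : ℝ}
    (hM : ∀ y ∈ Set.Icc a b, |g y| ≤ M) (hu : u ≠ 0) (hut : |u| ≤ t)
    (hx : x ∈ Set.Icc a b) (hxk : x + k * u ∈ Set.Icc a b) :
    |(fwdDiff u)^[k] g x| ≤ smoothOmega k g t a b := by
  have pos : ∀ v y : ℝ, 0 < v → v ≤ t → y ∈ Set.Icc a b → y + k * v ∈ Set.Icc a b →
      |(fwdDiff v)^[k] g y| ≤ smoothOmega k g t a b := by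
    intro v y hv hvt hy hyk
    refine le_csSup (bddAbove_smoothOmega_set hM) ⟨v, y + (k / 2 : ℝ) * v, hv, hvt, ?_⟩
    rw [kSymmDiff_add_half, if_pos ⟨hy.1, hyk.2⟩]
  rcases lt_or_gt_of_ne hu with h | h
  · rw [← abs_fwdDiff_iter_neg]
    rw [abs_of_neg h] at hut
    exact pos (-u) _ (by linarith) hut hxk (by simpa using hx)
  · rw [abs_of_pos h] at hut
    exact pos u x h hut hx hxk

lemma smoothOmega_mono {k : ℕ} {g : ℝ → ℝ} {a b M : ℝ}
    (hM : ∀ y ∈ Set.Icc a b, |g y| ≤ M) : Monotone fun t => smoothOmega k g t a b := by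
  intro s t hst
  refine smoothOmega_le (smoothOmega_nonneg _ _ _ _ _) fun u x hu hus hx hxk => ?_
  have hk : 0 ≤ k * u := by positivity
  exact abs_fwdDiff_iter_le_smoothOmega hM hu.ne' (by rw [abs_of_pos hu]; linarith)
    ⟨hx, by linarith⟩ ⟨by linarith, hxk⟩

lemma smoothOmega_le_of_bound {k : ℕ} {g : ℝ → ℝ} {a b M t : ℝ} (hM0 : 0 ≤ M)
    (hM : ∀ y ∈ Set.Icc a b, |g y| ≤ M) : smoothOmega k g t a b ≤ 2 ^ k * M := by
  refine smoothOmega_le (by positivity) fun u x hu hus hx hxk => ?_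
  have hk : 0 ≤ k * u := by positivity
  exact abs_fwdDiff_iter_le_of_bound hM ⟨hx, by linarith⟩ ⟨by linarith, hxk⟩

lemma smoothOmega_sub_polynomial {k : ℕ} (g : ℝ → ℝ) (P : Polynomial ℝ) (hP : P.natDegree < k)
    (t a b : ℝ) : smoothOmega k (fun y => g y - P.eval y) t a b = smoothOmega k g t a b := by
  have h : ∀ u x, kSymmDiff k (fun y => g y - P.eval y) u x a b = kSymmDiff k g u x a b := by
    intro u x
    have h1 := kSymmDiff_add_half k (fun y => g y - P.eval y) u (x - (k / 2 : ℝ) * u) a b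
    have h2 := kSymmDiff_add_half k g u (x - (k / 2 : ℝ) * u) a b
    rw [sub_add_cancel] at h1 h2
    rw [h1, h2, fwdDiff_iter_sub, fwdDiff_iter_polynomial_eq_zero P hP, sub_zero]
  simp only [smoothOmega, h]

lemma smoothOmega_doubling {j : ℕ} {g : ℝ → ℝ} {a b M s : ℝ}
    (hM : ∀ y ∈ Set.Icc a b, |g y| ≤ M) (hs : 4 * j * s ≤ b - a) :
    smoothOmega j g s a b ≤
      smoothOmega j g (2 * s) a b / 2 ^ j + j * smoothOmega (j + 1) g s a b := by
  have hnn := smoothOmega_nonneg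
  have h2 : (0 : ℝ) < 2 ^ j := by positivity
  have oneSided : ∀ u x : ℝ, u ≠ 0 → |u| ≤ s → x ∈ Set.Icc a b →
      x + 2 * j * u ∈ Set.Icc a b → |(fwdDiff u)^[j] g x| ≤
        smoothOmega j g (2 * s) a b / 2 ^ j + j * smoothOmega (j + 1) g s a b := by
    intro u x hu hus hx hx2
    have hpts : x + (2 * j : ℕ) * u ∈ Set.Icc a b := by push_cast; exact hx2
    have hW : ∀ p < j, |(fwdDiff u)^[j + 1] g (x + p * u)| ≤ smoothOmega (j + 1) g s a b := by
      intro p hp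
      refine abs_fwdDiff_iter_le_smoothOmega hM hu hus
        (fwdDiff_iter_points_mem hx hpts (by omega)) ?_
      have := fwdDiff_iter_points_mem hx hpts (show p + (j + 1) ≤ 2 * j by omega)
      rw [add_assoc, ← add_mul]
      exact_mod_cast this
    have h1 := abs_fwdDiff_iter_le_doubling g u x _ j hW
    have h3 : |(fwdDiff (2 * u))^[j] g x| ≤ smoothOmega j g (2 * s) a b := by
      refine abs_fwdDiff_iter_le_smoothOmega hM (mul_ne_zero two_ne_zero hu) ?_ hx ?_
      · rw [abs_mul, abs_two]; linarith
      · rwa [show x + j * (2 * u) = x + 2 * j * u by ring]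
    rw [← sub_le_iff_le_add, le_div_iff₀ h2]
    nlinarith
  refine smoothOmega_le ?_ fun u x hu hus hx hxk => ?_
  · exact add_nonneg (div_nonneg (hnn _ _ _ _ _) h2.le)
      (mul_nonneg (Nat.cast_nonneg _) (hnn _ _ _ _ _))
  · have hju : 0 ≤ j * u := by positivity
    have hjs : (j : ℝ) * u ≤ j * s := by gcongr
    rcases le_or_gt (x + 2 * j * u) b with hfit | hfit
    · exact oneSided u x hu.ne' (by rwa [abs_of_pos hu]) ⟨hx, by linarith⟩ ⟨by linarith, hfit⟩
    · rw [← abs_fwdDiff_iter_neg]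
      exact oneSided (-u) (x + j * u) (by simpa using hu.ne') (by rwa [abs_neg, abs_of_pos hu])
        ⟨by linarith, hxk⟩ ⟨by linarith, by linarith⟩

/-- The dyadic discretization of `s * ∫_s^{2 ^ n * s} ω_k(v) / v ^ 2 dv`. -/
noncomputable def dyadicOmegaSum (k : ℕ) (g : ℝ → ℝ) (a b s : ℝ) (n : ℕ) : ℝ :=
  ∑ i ∈ Finset.range n, smoothOmega k g (2 ^ i * s) a b / 2 ^ i

lemma dyadicOmegaSum_nonneg (k : ℕ) (g : ℝ → ℝ) (a b s : ℝ) (n : ℕ) :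
    0 ≤ dyadicOmegaSum k g a b s n :=
  Finset.sum_nonneg fun _ _ => div_nonneg (smoothOmega_nonneg _ _ _ _ _) (by positivity)

lemma dyadicOmegaSum_succ (k : ℕ) (g : ℝ → ℝ) (a b s : ℝ) (n : ℕ) :
    dyadicOmegaSum k g a b s (n + 1) =
      smoothOmega k g s a b + dyadicOmegaSum k g a b (2 * s) n / 2 := by
  rw [dyadicOmegaSum, Finset.sum_range_succ', dyadicOmegaSum, Finset.sum_div, add_comm]
  simp only [pow_zero, one_mul, div_one, pow_succ]
  congr 1
  refine Finset.sum_congr rfl fun i _ => ?_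
  rw [mul_assoc, div_div]

lemma smoothOmega_one_le_dyadicOmegaSum_two {g : ℝ → ℝ} {a b M s : ℝ} {n : ℕ}
    (hM : ∀ y ∈ Set.Icc a b, |g y| ≤ M) (hs : 0 < s) (hn : 8 * (2 ^ n * s) ≤ b - a) :
    smoothOmega 1 g s a b ≤
      dyadicOmegaSum 2 g a b s n + smoothOmega 1 g (2 ^ n * s) a b / 2 ^ n := by
  induction n generalizing s with
  | zero => simp [dyadicOmegaSum]
  | succ n ih =>
    have h1 := ih (s := 2 * s) (by linarith) (by rw [pow_succ] at hn; linarith)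
    have h2n : (1 : ℝ) ≤ 2 ^ n := one_le_pow₀ (by norm_num)
    have h2 := smoothOmega_doubling (j := 1) (s := s) hM (by
      rw [pow_succ] at hn
      push_cast
      nlinarith)
    rw [dyadicOmegaSum_succ]
    rw [show (2 : ℝ) ^ n * (2 * s) = 2 ^ (n + 1) * s by ring] at h1
    rw [pow_succ (2 : ℝ) n, ← div_div]
    rw [← pow_succ]
    push_cast at h2
    norm_num at h2
    linarith

lemma dyadicOmegaSum_le_succ_order {k : ℕ} (hk : 2 ≤ k) {g : ℝ → ℝ} {a b M s : ℝ} {n : ℕ}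
    (hM0 : 0 ≤ M) (hM : ∀ y ∈ Set.Icc a b, |g y| ≤ M) (hs : 0 < s)
    (hn : 4 * k * (2 ^ n * s) ≤ b - a) :
    dyadicOmegaSum k g a b s n ≤
      2 * k * dyadicOmegaSum (k + 1) g a b s n + 2 ^ k * M / 2 ^ n := by
  have hterm : ∀ i ∈ Finset.range n, smoothOmega k g (2 ^ i * s) a b / 2 ^ i ≤
      1 / 2 * (smoothOmega k g (2 ^ (i + 1) * s) a b / 2 ^ (i + 1)) +
        k * (smoothOmega (k + 1) g (2 ^ i * s) a b / 2 ^ i) := by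
    intro i hi
    have hin : (2 : ℝ) ^ i ≤ 2 ^ n :=
      pow_le_pow_right₀ (by norm_num) (Finset.mem_range.mp hi).le
    have h1 := smoothOmega_doubling (j := k) (s := 2 ^ i * s) hM
      (le_trans (by gcongr) hn)
    rw [show (2 : ℝ) * (2 ^ i * s) = 2 ^ (i + 1) * s by ring] at h1
    have h4 : smoothOmega k g (2 ^ (i + 1) * s) a b / 2 ^ k ≤
        smoothOmega k g (2 ^ (i + 1) * s) a b / 4 := by
      refine div_le_div_of_nonneg_left (smoothOmega_nonneg _ _ _ _ _) (by norm_num) ?_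
      calc (4 : ℝ) = 2 ^ 2 := by norm_num
        _ ≤ 2 ^ k := pow_le_pow_right₀ (by norm_num) hk
    have h5 : smoothOmega k g (2 ^ i * s) a b ≤ smoothOmega k g (2 ^ (i + 1) * s) a b / 4 +
        k * smoothOmega (k + 1) g (2 ^ i * s) a b := by linarith
    have h6 := div_le_div_of_nonneg_right h5 (by positivity : (0 : ℝ) ≤ 2 ^ i)
    refine h6.trans_eq ?_
    rw [pow_succ (2 : ℝ) i]
    field_simp
    ring
  have hsum := Finset.sum_le_sum hterm
  rw [Finset.sum_add_distrib, ← Finset.mul_sum, ← Finset.mul_sum] at hsum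
  have hshift : ∑ i ∈ Finset.range n, smoothOmega k g (2 ^ (i + 1) * s) a b / 2 ^ (i + 1) ≤
      dyadicOmegaSum k g a b s n + smoothOmega k g (2 ^ n * s) a b / 2 ^ n := by
    have e1 := Finset.sum_range_succ (fun i => smoothOmega k g (2 ^ i * s) a b / 2 ^ i) n
    have e2 := Finset.sum_range_succ' (fun i => smoothOmega k g (2 ^ i * s) a b / 2 ^ i) n
    have e3 : 0 ≤ smoothOmega k g (2 ^ 0 * s) a b / 2 ^ 0 :=
      div_nonneg (smoothOmega_nonneg _ _ _ _ _) (by positivity)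
    rw [dyadicOmegaSum]
    linarith
  have hlast : smoothOmega k g (2 ^ n * s) a b / 2 ^ n ≤ 2 ^ k * M / 2 ^ n := by
    gcongr
    exact smoothOmega_le_of_bound hM0 hM
  unfold dyadicOmegaSum at hshift ⊢
  linarith

lemma exists_smoothOmega_one_le_dyadicOmegaSum (k : ℕ) (hk : 2 ≤ k) :
    ∃ C : ℝ, 0 < C ∧ ∀ (g : ℝ → ℝ) (a b M s : ℝ) (n : ℕ), 0 ≤ M →
      (∀ y ∈ Set.Icc a b, |g y| ≤ M) → 0 < s → 4 * k * (2 ^ n * s) ≤ b - a →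
      smoothOmega 1 g s a b ≤ C * (dyadicOmegaSum k g a b s n + M / 2 ^ n) := by
  induction k, hk using Nat.le_induction with
  | base =>
    refine ⟨2, by norm_num, fun g a b M s n hM0 hM hs hn => ?_⟩
    have h1 := smoothOmega_one_le_dyadicOmegaSum_two hM hs (by push_cast at hn; linarith)
    have h2 : smoothOmega 1 g (2 ^ n * s) a b / 2 ^ n ≤ 2 ^ 1 * M / 2 ^ n := by
      gcongr
      exact smoothOmega_le_of_bound hM0 hM
    have h3 := dyadicOmegaSum_nonneg 2 g a b s n
    rw [pow_one, mul_div_assoc] at h2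
    linarith
  | succ k hk ih =>
    obtain ⟨C, hC, h⟩ := ih
    refine ⟨C * (2 * k + (2 ^ k + 1)), by positivity, fun g a b M s n hM0 hM hs hn => ?_⟩
    have hn' : 4 * k * (2 ^ n * s) ≤ b - a := by
      refine le_trans ?_ hn
      push_cast
      gcongr
      linarith
    refine (h g a b M s n hM0 hM hs hn').trans ?_
    rw [mul_assoc]
    refine mul_le_mul_of_nonneg_left ?_ hC.le
    have h1 := dyadicOmegaSum_le_succ_order hk hM0 hM hs hn'
    have h2 := dyadicOmegaSum_nonneg (k + 1) g a b s n
    have h3 : 0 ≤ M / 2 ^ n := by positivity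
    rw [mul_div_assoc] at h1
    have h4 : 0 ≤ (2 ^ k + 1 : ℝ) * dyadicOmegaSum (k + 1) g a b s n := by positivity
    have h5 : 0 ≤ (2 * k : ℝ) * (M / 2 ^ n) := by positivity
    linarith

lemma integrableOn_smoothOmega_div_sq {k : ℕ} {g : ℝ → ℝ} {a b M s c : ℝ}
    (hM : ∀ y ∈ Set.Icc a b, |g y| ≤ M) (hs : 0 < s) :
    MeasureTheory.IntegrableOn (fun v => smoothOmega k g v a b / v ^ 2) (Set.Ioc s c) := by
  have h1 : MeasureTheory.IntegrableOn (fun v => smoothOmega k g v a b) (Set.Icc s c) :=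
    ((smoothOmega_mono hM).monotoneOn _).integrableOn_isCompact isCompact_Icc
  have h2 : ContinuousOn (fun v : ℝ => (v ^ 2)⁻¹) (Set.Icc s c) :=
    ContinuousOn.inv₀ (by fun_prop) fun v hv => by
      have : 0 < v := hs.trans_le hv.1
      positivity
  simp only [div_eq_mul_inv]
  exact (h1.mul_continuousOn h2 isCompact_Icc).mono_set Set.Ioc_subset_Icc_self

lemma setIntegral_smoothOmega_nonneg (k : ℕ) (g : ℝ → ℝ) (a b s c : ℝ) :
    0 ≤ ∫ v in Set.Ioc s c, smoothOmega k g v a b / v ^ 2 :=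
  MeasureTheory.integral_nonneg fun v => div_nonneg (smoothOmega_nonneg _ _ _ _ _) (sq_nonneg v)

lemma smoothOmega_le_integral {k : ℕ} {g : ℝ → ℝ} {a b M s : ℝ}
    (hM : ∀ y ∈ Set.Icc a b, |g y| ≤ M) (hs : 0 < s) :
    smoothOmega k g s a b ≤
      4 * s * ∫ v in Set.Ioc s (2 * s), smoothOmega k g v a b / v ^ 2 := by
  have h := MeasureTheory.setIntegral_mono_on
    (f := fun _ => smoothOmega k g s a b / (2 * s) ^ 2) (μ := MeasureTheory.volume)
    (s := Set.Ioc s (2 * s)) (by simp) (integrableOn_smoothOmega_div_sq (k := k) hM hs)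
    measurableSet_Ioc (fun v hv => by
      have hv0 : 0 < v := hs.trans hv.1
      exact div_le_div₀ (smoothOmega_nonneg _ _ _ _ _) (smoothOmega_mono hM hv.1.le)
        (by positivity) (pow_le_pow_left₀ hv0.le hv.2 2))
  rw [MeasureTheory.setIntegral_const, Real.volume_real_Ioc_of_le (by linarith),
    smul_eq_mul] at h
  calc smoothOmega k g s a b
      = 4 * s * ((2 * s - s) * (smoothOmega k g s a b / (2 * s) ^ 2)) := by
        field_simp
        ring
    _ ≤ _ := by gcongr

lemma dyadicOmegaSum_le_integral {k : ℕ} {g : ℝ → ℝ} {a b M s c : ℝ} {n : ℕ}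
    (hM : ∀ y ∈ Set.Icc a b, |g y| ≤ M) (hs : 0 < s) (hc : 2 ^ n * s ≤ c) :
    dyadicOmegaSum k g a b s n ≤
      4 * s * ∫ v in Set.Ioc s c, smoothOmega k g v a b / v ^ 2 := by
  induction n generalizing s with
  | zero =>
    have := setIntegral_smoothOmega_nonneg k g a b s c
    simp only [dyadicOmegaSum, Finset.range_zero, Finset.sum_empty]
    positivity
  | succ n ih =>
    have h2n : (1 : ℝ) ≤ 2 ^ n := one_le_pow₀ (by norm_num)
    rw [pow_succ] at hc
    have hc2 : 2 * s ≤ c := by nlinarith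
    have h1 := ih (s := 2 * s) (by linarith) (by linarith)
    have h2 := smoothOmega_le_integral (k := k) hM hs
    rw [dyadicOmegaSum_succ, ← Set.Ioc_union_Ioc_eq_Ioc (by linarith : s ≤ 2 * s) hc2,
      MeasureTheory.setIntegral_union (Set.Ioc_disjoint_Ioc_of_le le_rfl) measurableSet_Ioc
        (integrableOn_smoothOmega_div_sq hM hs)
        (integrableOn_smoothOmega_div_sq hM (by linarith))]
    linarith

/-- Marchaud's inequality on a compact interval. -/
lemma exists_marchaud (k : ℕ) (hk : 2 ≤ k) :
    ∃ C : ℝ, 0 < C ∧ ∀ (g : ℝ → ℝ) (a b M s : ℝ), a < b → 0 ≤ M →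
      (∀ y ∈ Set.Icc a b, |g y| ≤ M) → 0 < s →
      smoothOmega 1 g s a b ≤ C * s *
        ((∫ v in Set.Ioc s (2 * (b - a)), smoothOmega k g v a b / v ^ 2) + M / (b - a)) := by
  obtain ⟨C, hC, h⟩ := exists_smoothOmega_one_le_dyadicOmegaSum k hk
  refine ⟨(C + 1) * (8 * k), by positivity, fun g a b M s hab hM0 hM hs => ?_⟩
  have hl : 0 < b - a := sub_pos.mpr hab
  have hJ := setIntegral_smoothOmega_nonneg k g a b s (2 * (b - a))
  set J := ∫ v in Set.Ioc s (2 * (b - a)), smoothOmega k g v a b / v ^ 2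
  have hk1 : (2 : ℝ) ≤ k := by exact_mod_cast hk
  have hks : 0 < 4 * k * s := by positivity
  rcases le_or_gt (4 * k * s) (b - a) with hsmall | hlarge
  · obtain ⟨n, hn1, hn2⟩ := exists_nat_pow_near (x := (b - a) / (4 * k * s)) (y := (2 : ℝ))
      (by rwa [one_le_div hks]) (by norm_num)
    rw [le_div_iff₀ hks] at hn1
    rw [div_lt_iff₀ hks] at hn2
    have hT := dyadicOmegaSum_le_integral (k := k) (n := n) (c := 2 * (b - a)) hM hs (by
      have : 0 < 2 ^ n * s := by positivity
      nlinarith)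
    have hMn : M / 2 ^ n ≤ 8 * k * s * (M / (b - a)) := by
      rw [div_le_iff₀ (by positivity)]
      have : M = M / (b - a) * (b - a) := by field_simp
      have h0 : 0 ≤ M / (b - a) := by positivity
      calc M = M / (b - a) * (b - a) := this
        _ ≤ M / (b - a) * (2 ^ (n + 1) * (4 * k * s)) := by gcongr
        _ = 8 * k * s * (M / (b - a)) * 2 ^ n := by ring
    have hT' : dyadicOmegaSum k g a b s n ≤ 8 * k * s * J := by
      refine hT.trans ?_
      gcongr
      linarith
    calc smoothOmega 1 g s a b ≤ C * (dyadicOmegaSum k g a b s n + M / 2 ^ n) :=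
          h g a b M s n hM0 hM hs (by linarith)
      _ ≤ (C + 1) * (8 * k * s * J + 8 * k * s * (M / (b - a))) := by
        have := dyadicOmegaSum_nonneg k g a b s n
        gcongr
        linarith
      _ = _ := by ring
  · have h1 := smoothOmega_le_of_bound (k := 1) (t := s) hM0 hM
    have h0 : 0 ≤ M / (b - a) := by positivity
    calc smoothOmega 1 g s a b ≤ 2 * (M / (b - a) * (b - a)) := by
          rw [div_mul_cancel₀ _ hl.ne']; linarith
      _ ≤ 2 * (M / (b - a) * (4 * k * s)) := by gcongr
      _ = 1 * (8 * k) * s * (0 + M / (b - a)) := by ring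
      _ ≤ _ := by gcongr; linarith

lemma abs_le_pow_of_abs_fwdDiff_iter_le {k : ℕ} (e : ℕ → ℝ) {W : ℝ} (hW : 0 ≤ W) (N : ℕ)
    (h0 : ∀ i < k, e i = 0)
    (hd : ∀ i, i + k ≤ N → |∑ l ∈ Finset.range (k + 1),
      (-1 : ℝ) ^ (k - l) * (k.choose l) * e (i + l)| ≤ W) :
    ∀ i ≤ N, |e i| ≤ (2 ^ k) ^ i * W := by
  intro i
  induction i using Nat.strong_induction_on with
  | _ i ih =>
    intro hi
    rcases lt_or_ge i k with hik | hik
    · rw [h0 i hik, abs_zero]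
      positivity
    · obtain ⟨p, rfl⟩ := Nat.exists_eq_add_of_le' hik
      have hmain := hd p hi
      rw [Finset.sum_range_succ] at hmain
      simp only [Nat.sub_self, pow_zero, Nat.choose_self, Nat.cast_one, one_mul] at hmain
      rcases Nat.eq_zero_or_pos k with rfl | hk
      · simpa using hmain
      set B : ℝ := (2 ^ k) ^ (p + k - 1) * W with hB
      have h2k : (1 : ℝ) ≤ 2 ^ k := one_le_pow₀ (by norm_num)
      have hWB : W ≤ B := le_mul_of_one_le_left hW (one_le_pow₀ h2k)
      have hsum : |∑ l ∈ Finset.range k, (-1 : ℝ) ^ (k - l) * (k.choose l) * e (p + l)| ≤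
          (2 ^ k - 1) * B := by
        have hcard : ∑ l ∈ Finset.range k, (k.choose l : ℝ) = 2 ^ k - 1 := by
          have := Nat.sum_range_choose k
          rw [Finset.sum_range_succ, Nat.choose_self] at this
          rw [eq_sub_iff_add_eq]
          exact_mod_cast this
        rw [← hcard, Finset.sum_mul]
        refine (Finset.abs_sum_le_sum_abs _ _).trans (Finset.sum_le_sum fun l hl => ?_)
        have hl' := Finset.mem_range.mp hl
        rw [abs_mul, abs_mul, abs_pow, abs_neg, abs_one, one_pow, one_mul, Nat.abs_cast]
        refine mul_le_mul_of_nonneg_left ?_ (Nat.cast_nonneg _)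
        refine (ih (p + l) (by omega) (by omega)).trans ?_
        exact mul_le_mul_of_nonneg_right (pow_le_pow_right₀ h2k (by omega)) hW
      have hfin : (2 ^ k : ℝ) ^ (p + k) * W = 2 ^ k * B := by
        rw [hB, ← mul_assoc, ← pow_succ', show p + k - 1 + 1 = p + k by omega]
      rw [hfin]
      rw [abs_le] at hmain hsum ⊢
      constructor <;> nlinarith [hmain.1, hmain.2, hsum.1, hsum.2]

lemma exists_polynomial_abs_sub_le_on_grid {k N : ℕ} (hk : 1 ≤ k) {g : ℝ → ℝ}
    {a b M s : ℝ} (hM : ∀ y ∈ Set.Icc a b, |g y| ≤ M) (hs : 0 < s) (hsN : a + N * s ≤ b) :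
    ∃ P : Polynomial ℝ, P.natDegree < k ∧ ∀ i ≤ N,
      |g (a + i * s) - P.eval (a + i * s)| ≤ (2 ^ k) ^ N * smoothOmega k g (b - a) a b := by
  set v : ℕ → ℝ := fun i => a + i * s with hv
  have hinj : Set.InjOn v (Finset.range k) := by
    intro i _ j _ hij
    have : (i : ℝ) * s = j * s := by simpa [hv] using hij
    exact_mod_cast mul_right_cancel₀ hs.ne' this
  set P := Lagrange.interpolate (Finset.range k) v (fun i => g (v i)) with hP
  have hdeg : P.natDegree < k := by
    rcases eq_or_ne P 0 with h | h
    · rw [h, Polynomial.natDegree_zero]; omega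
    · rw [Polynomial.natDegree_lt_iff_degree_lt h]
      have hlt := Lagrange.degree_interpolate_lt (fun i => g (v i)) hinj
      rwa [Finset.card_range] at hlt
  refine ⟨P, hdeg, fun i hi => ?_⟩
  have hmem : ∀ j ≤ N, a + j * s ∈ Set.Icc a b := fun j hj => by
    have : (j : ℝ) * s ≤ N * s := by gcongr
    have h0 : 0 ≤ (j : ℝ) * s := by positivity
    exact ⟨by linarith, by linarith⟩
  have hW := smoothOmega_nonneg k g (b - a) a b
  have key := abs_le_pow_of_abs_fwdDiff_iter_le (k := k)
    (fun j => g (v j) - P.eval (v j)) hW N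
    (fun j hj => by
      rw [hP, Lagrange.eval_interpolate_at_node _ hinj (Finset.mem_coe.2 (Finset.mem_range.2 hj)),
        sub_self])
    (fun j hj => by
      have hlen : s ≤ b - a := by
        have h1 : (1 : ℝ) ≤ N := by exact_mod_cast (by omega : 1 ≤ N)
        nlinarith
      have h := abs_fwdDiff_iter_le_smoothOmega (k := k) (t := b - a) hM hs.ne'
        (by rwa [abs_of_pos hs]) (hmem j (by omega))
        (by
          have := hmem (j + k) hj
          push_cast at this
          rwa [add_assoc, ← add_mul])
      have hz := fwdDiff_iter_polynomial_eq_zero P hdeg s (a + j * s)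
      have hd := fwdDiff_iter_sub g (fun y => P.eval y) s k (a + j * s)
      rw [hz, sub_zero] at hd
      rw [← hd, fwdDiff_iter_eq_real_sum] at h
      have hcast : ∀ l : ℕ, v (j + l) = a + j * s + l * s := fun l => by
        simp only [hv]
        push_cast
        ring
      simp only [hcast]
      exact h) i hi
  refine key.trans (mul_le_mul_of_nonneg_right (pow_le_pow_right₀ ?_ hi) hW)
  exact one_le_pow₀ (by norm_num)

/-- Whitney's inequality on a compact interval. -/
lemma exists_whitney (k : ℕ) (hk : 2 ≤ k) :
    ∃ C : ℝ, 0 < C ∧ ∀ (g : ℝ → ℝ) (a b : ℝ), a < b → ContinuousOn g (Set.Icc a b) →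
      ∃ P : Polynomial ℝ, P.natDegree < k ∧ ∀ x ∈ Set.Icc a b,
        |g x - P.eval x| ≤ C * smoothOmega k g (b - a) a b := by
  obtain ⟨C, hC, h⟩ := exists_smoothOmega_one_le_dyadicOmegaSum k hk
  obtain ⟨n, hn⟩ := pow_unbounded_of_one_lt (2 * C) (by norm_num : (1 : ℝ) < 2)
  set N : ℕ := 4 * k * 2 ^ n with hN
  have hNpos : (0 : ℝ) < N := by
    have : 0 < N := by positivity
    exact_mod_cast this
  refine ⟨2 * ((2 ^ k) ^ N + 2 * C), by positivity, fun g a b hab hg => ?_⟩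
  have hl : 0 < b - a := sub_pos.mpr hab
  set s := (b - a) / N with hs
  have hspos : 0 < s := by positivity
  have hNs : N * s = b - a := by rw [hs]; field_simp
  obtain ⟨M₀, hM₀⟩ := (isCompact_Icc (a := a) (b := b)).exists_bound_of_continuousOn hg
  obtain ⟨P, hdeg, hP⟩ := exists_polynomial_abs_sub_le_on_grid (k := k) (N := N) (s := s)
    (by omega) (fun y hy => hM₀ y hy) hspos (by linarith)
  refine ⟨P, hdeg, ?_⟩
  set e : ℝ → ℝ := fun y => g y - P.eval y with he
  have hecont : ContinuousOn (fun y => |e y|) (Set.Icc a b) :=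
    (hg.sub P.continuous.continuousOn).abs
  obtain ⟨x₀, hx₀, hmax⟩ := isCompact_Icc.exists_isMaxOn (Set.nonempty_Icc.2 hab.le) hecont
  set M := |e x₀| with hM
  have heM : ∀ y ∈ Set.Icc a b, |e y| ≤ M := fun y hy => hmax hy
  have hWe : ∀ t, smoothOmega k e t a b = smoothOmega k g t a b :=
    fun t => smoothOmega_sub_polynomial g P hdeg t a b
  have hW := smoothOmega_nonneg k g (b - a) a b
  have h1 := h e a b M s n (abs_nonneg _) heM hspos (by
    rw [← hNs, hN]
    push_cast
    exact le_of_eq (by ring))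
  have hT : dyadicOmegaSum k e a b s n ≤ 2 * smoothOmega k g (b - a) a b := by
    have hterm : ∀ i ∈ Finset.range n, smoothOmega k e (2 ^ i * s) a b / 2 ^ i ≤
        (1 / 2) ^ i * smoothOmega k g (b - a) a b := by
      intro i hi
      rw [hWe, one_div, inv_pow, div_eq_inv_mul]
      refine mul_le_mul_of_nonneg_left (smoothOmega_mono hM₀ ?_) (by positivity)
      rw [← hNs, hN]
      refine mul_le_mul_of_nonneg_right ?_ hspos.le
      have h2 : (2 : ℝ) ^ i ≤ 2 ^ n :=
        pow_le_pow_right₀ (by norm_num) (Finset.mem_range.mp hi).le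
      have h3 : (2 : ℝ) ≤ k := by exact_mod_cast hk
      have h4 : (0 : ℝ) < 2 ^ n := by positivity
      push_cast
      nlinarith
    refine (Finset.sum_le_sum hterm).trans ?_
    rw [← Finset.sum_mul]
    refine mul_le_mul_of_nonneg_right ?_ hW
    exact sum_geometric_two_le n
  have hMn : C * (M / 2 ^ n) ≤ M / 2 := by
    have hM0 : 0 ≤ M := abs_nonneg _
    rw [mul_div_assoc', div_le_div_iff₀ (by positivity) (by norm_num)]
    nlinarith
  set i := ⌊(x₀ - a) / s⌋₊ with hi
  have hx₀a : 0 ≤ (x₀ - a) / s := div_nonneg (by linarith [hx₀.1]) hspos.le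
  have hi1 : i * s ≤ x₀ - a := by
    rw [← le_div_iff₀ hspos]; exact Nat.floor_le hx₀a
  have hi2 : x₀ - a < (i + 1) * s := by
    rw [← div_lt_iff₀ hspos]; exact Nat.lt_floor_add_one _
  have hiN : i ≤ N := by
    have : (i : ℝ) * s ≤ N * s := by linarith [hx₀.2]
    exact_mod_cast le_of_mul_le_mul_right this hspos
  have hgrid := hP i hiN
  have hstep : |e x₀ - e (a + i * s)| ≤ smoothOmega 1 e s a b := by
    rcases eq_or_ne x₀ (a + i * s) with heq | hne
    · rw [← heq, sub_self, abs_zero]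
      exact smoothOmega_nonneg _ _ _ _ _
    · have hi0 : 0 ≤ (i : ℝ) * s := by positivity
      have := abs_fwdDiff_iter_le_smoothOmega (k := 1) (t := s) (x := a + i * s)
        (u := x₀ - (a + i * s)) heM (sub_ne_zero.2 hne)
        (by rw [abs_of_nonneg (by linarith)]; linarith)
        ⟨by linarith, by linarith [hx₀.2]⟩ (by simpa using hx₀)
      simpa [fwdDiff] using this
  have htri : M ≤ |e x₀ - e (a + i * s)| + |e (a + i * s)| := by
    rw [hM]
    have := abs_add_le (e x₀ - e (a + i * s)) (e (a + i * s))
    rwa [sub_add_cancel] at this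
  intro x hx
  refine (heM x hx).trans ?_
  have hCT := mul_le_mul_of_nonneg_left hT hC.le
  change |e (a + i * s)| ≤ _ at hgrid
  linarith

lemma eq_zero_of_iterate_derivative_eval_eq_zero {r n : ℕ} {y : Fin n → ℝ}
    (hy : Function.Injective y) {Q : Polynomial ℝ} (hdeg : Q.natDegree < (r + 1) * n)
    (h : ∀ ν, ∀ j ≤ r, (Polynomial.derivative^[j] Q).eval (y ν) = 0) : Q = 0 := by
  by_contra hQ
  have hdvd : ∏ ν, (Polynomial.X - Polynomial.C (y ν)) ^ (r + 1) ∣ Q := by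
    refine Finset.prod_dvd_of_coprime (fun i _ j _ hij => ?_) fun ν _ => ?_
    · exact (Polynomial.pairwise_coprime_X_sub_C hy hij).pow
    · rw [← Polynomial.le_rootMultiplicity_iff hQ]
      exact (Polynomial.lt_rootMultiplicity_iff_isRoot_iterate_derivative hQ).2 (h ν)
  have hle := Polynomial.natDegree_le_of_dvd hdvd hQ
  rw [Polynomial.natDegree_prod_of_monic _ _ fun i _ => (Polynomial.monic_X_sub_C _).pow _] at hle
  simp only [Polynomial.natDegree_pow, Polynomial.natDegree_X_sub_C, Finset.sum_const,
    Finset.card_univ, Fintype.card_fin, smul_eq_mul, mul_one] at hle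
  rw [mul_comm n] at hle
  omega

lemma eval_iterate_derivative_sum {N : ℕ} (c : Fin N → ℝ) (j : ℕ) (x : ℝ) :
    (Polynomial.derivative^[j]
      (∑ i, Polynomial.C (c i) * Polynomial.X ^ (i : ℕ) : Polynomial ℝ)).eval x =
      ∑ i, c i * ((i : ℕ).descFactorial j * x ^ ((i : ℕ) - j)) := by
  rw [Polynomial.iterate_derivative_sum, Polynomial.eval_finsetSum]
  refine Finset.sum_congr rfl fun i _ => ?_
  rw [Polynomial.iterate_derivative_C_mul, Polynomial.iterate_derivative_X_pow_eq_natCast_mul]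
  simp

/-- Knots in the unit interval with pairwise distances at least `lam`. -/
def separatedUnitKnots (n : ℕ) (lam : ℝ) : Set (Fin n → ℝ) :=
  {y | (∀ i, y i ∈ Set.Icc (0 : ℝ) 1) ∧ ∀ i j, i < j → lam ≤ y j - y i}

lemma isCompact_separatedUnitKnots (n : ℕ) (lam : ℝ) : IsCompact (separatedUnitKnots n lam) := by
  have h1 : IsCompact (Set.univ.pi fun _ : Fin n => Set.Icc (0 : ℝ) 1) :=
    isCompact_univ_pi fun _ => isCompact_Icc
  have h2 : IsClosed {y : Fin n → ℝ | ∀ i j, i < j → lam ≤ y j - y i} := by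
    simp only [Set.ofPred_forall]
    exact isClosed_iInter fun i => isClosed_iInter fun j => isClosed_iInter fun _ =>
      isClosed_le continuous_const (by fun_prop)
  convert h1.inter_right h2 using 1
  ext y
  simp only [separatedUnitKnots, Set.mem_inter_iff, Set.mem_ofPred_eq, Set.mem_univ_pi]

lemma exists_norm_coeff_le_hermite_data (r n : ℕ) {lam : ℝ} (hlam : 0 < lam) :
    ∃ C : ℝ, 0 < C ∧ ∀ c : Fin ((r + 1) * n) → ℝ, ∀ y ∈ separatedUnitKnots n lam,
      ‖c‖ ≤ C * ∑ ν, ∑ j ∈ Finset.range (r + 1),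
        |∑ i, c i * ((i : ℕ).descFactorial j * y ν ^ ((i : ℕ) - j))| := by
  set Φ : (Fin ((r + 1) * n) → ℝ) × (Fin n → ℝ) → ℝ := fun p =>
    ∑ ν, ∑ j ∈ Finset.range (r + 1),
      |∑ i, p.1 i * ((i : ℕ).descFactorial j * p.2 ν ^ ((i : ℕ) - j))| with hΦ
  have hcont : Continuous Φ := by fun_prop
  have hK : IsCompact (Metric.sphere (0 : Fin ((r + 1) * n) → ℝ) 1 ×ˢ separatedUnitKnots n lam) :=
    (isCompact_sphere _ _).prod (isCompact_separatedUnitKnots n lam)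
  obtain ⟨ε, hε, hmin⟩ := hK.exists_forall_le' hcont.continuousOn (a := 0) (by
    rintro ⟨c, y⟩ ⟨hc, hy⟩
    refine lt_of_le_of_ne (by positivity) fun h0 => ?_
    have hzero : ∀ ν, ∀ j ∈ Finset.range (r + 1),
        ∑ i, c i * ((i : ℕ).descFactorial j * y ν ^ ((i : ℕ) - j)) = 0 := by
      intro ν j hj
      have h1 := (Finset.sum_eq_zero_iff_of_nonneg (fun ν _ => by positivity)).1 h0.symm ν
        (Finset.mem_univ _)
      exact abs_eq_zero.1 ((Finset.sum_eq_zero_iff_of_nonneg (fun j _ => by positivity)).1 h1 j hj)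
    have hinj : Function.Injective y := by
      intro i j hij
      rcases lt_trichotomy i j with h | h | h
      · linarith [hy.2 i j h]
      · exact h
      · linarith [hy.2 j i h]
    set Q : Polynomial ℝ := ∑ i, Polynomial.C (c i) * Polynomial.X ^ (i : ℕ) with hQdef
    have hcoeff : ∀ i : Fin ((r + 1) * n), Q.coeff i = c i := by
      intro i
      simp [hQdef, Polynomial.finsetSum_coeff, Polynomial.coeff_X_pow, Fin.val_inj]
    have hcne : c ≠ 0 := by
      rintro rfl
      simp at hc
    obtain ⟨i₀, hi₀⟩ := Function.ne_iff.1 hcne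
    have hdeg : Q.natDegree < (r + 1) * n := by
      have hpos : 0 < (r + 1) * n := i₀.pos
      have : Q.natDegree ≤ (r + 1) * n - 1 :=
        Polynomial.natDegree_sum_le_of_forall_le _ _ fun i _ =>
          (Polynomial.natDegree_C_mul_X_pow_le _ _).trans (by omega)
      omega
    have hQ := eq_zero_of_iterate_derivative_eval_eq_zero hinj hdeg fun ν j hj => by
      rw [hQdef, eval_iterate_derivative_sum]
      exact hzero ν j (Finset.mem_range.2 (by omega))
    apply hi₀
    rw [← hcoeff, hQ, Polynomial.coeff_zero, Pi.zero_apply])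
  refine ⟨ε⁻¹, inv_pos.2 hε, fun c y hy => ?_⟩
  change ‖c‖ ≤ ε⁻¹ * Φ (c, y)
  rcases eq_or_ne c 0 with rfl | hc
  · rw [norm_zero]
    have : 0 ≤ Φ (0, y) := by positivity
    positivity
  have hcn : 0 < ‖c‖ := norm_pos_iff.2 hc
  have h1 := hmin (‖c‖⁻¹ • c, y) ⟨by
    rw [mem_sphere_zero_iff_norm, norm_smul, norm_inv, norm_norm, inv_mul_cancel₀ hcn.ne'], hy⟩
  have h2 : Φ (‖c‖⁻¹ • c, y) = ‖c‖⁻¹ * Φ (c, y) := by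
    simp only [hΦ, Pi.smul_apply, smul_eq_mul, mul_assoc, ← Finset.mul_sum, abs_mul, abs_inv,
      abs_norm]
  rw [h2, le_inv_mul_iff₀ hcn] at h1
  rw [le_inv_mul_iff₀ hε]
  linarith

lemma iterate_derivative_comp_affine (Q : Polynomial ℝ) (h c : ℝ) (j : ℕ) :
    Polynomial.derivative^[j] (Q.comp (Polynomial.C h * Polynomial.X + Polynomial.C c)) =
      Polynomial.C (h ^ j) * (Polynomial.derivative^[j] Q).comp
        (Polynomial.C h * Polynomial.X + Polynomial.C c) := by
  induction j with
  | zero => simp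
  | succ j ih =>
    rw [Function.iterate_succ_apply', ih, Function.iterate_succ_apply',
      Polynomial.derivative_C_mul, Polynomial.derivative_comp]
    simp only [Polynomial.derivative_add, Polynomial.derivative_C, Polynomial.derivative_mul,
      Polynomial.derivative_X, pow_succ, Polynomial.C_mul]
    ring

lemma exists_derivative_bound_of_hermite_data (r n : ℕ) {lam : ℝ} (hlam : 0 < lam) :
    ∃ C : ℝ, 0 < C ∧ ∀ (a h B : ℝ) (y : Fin n → ℝ) (Q : Polynomial ℝ), 0 < h →
      y ∈ separatedUnitKnots n lam → Q.natDegree < (r + 1) * n →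
      (∀ ν, ∀ j ≤ r, |(Polynomial.derivative^[j] Q).eval (h * y ν + a)| ≤ B * h ^ (r - j)) →
      ∀ x ∈ Set.Icc (0 : ℝ) 1, |(Polynomial.derivative^[r] Q).eval (h * x + a)| ≤ C * B := by
  obtain ⟨C, hC, hmain⟩ := exists_norm_coeff_le_hermite_data r n hlam
  set D : ℝ := ∑ i : Fin ((r + 1) * n), ((i : ℕ).descFactorial r : ℝ) with hD
  have hD0 : 0 ≤ D := by positivity
  refine ⟨C * (n * (r + 1)) * D + 1, by positivity, fun a h B y Q hh hy hdeg hdata x hx => ?_⟩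
  set R := Q.comp (Polynomial.C h * Polynomial.X + Polynomial.C a) with hR
  have hRdeg : R.natDegree < (r + 1) * n := by
    refine lt_of_le_of_lt (Polynomial.natDegree_comp_le.trans ?_) hdeg
    exact (Nat.mul_le_mul_left _ Polynomial.natDegree_linear_le).trans_eq (mul_one _)
  have hReval : ∀ j t, (Polynomial.derivative^[j] R).eval t =
      h ^ j * (Polynomial.derivative^[j] Q).eval (h * t + a) := by
    intro j t
    rw [hR, iterate_derivative_comp_affine]
    simp
  set c : Fin ((r + 1) * n) → ℝ := fun i => R.coeff i with hc
  have hRsum : R = ∑ i, Polynomial.C (c i) * Polynomial.X ^ (i : ℕ) := by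
    rw [Fin.sum_univ_eq_sum_range (fun i => Polynomial.C (R.coeff i) * Polynomial.X ^ i)]
    exact R.as_sum_range_C_mul_X_pow' hRdeg
  have hexp : ∀ j t, h ^ j * (Polynomial.derivative^[j] Q).eval (h * t + a) =
      ∑ i, c i * ((i : ℕ).descFactorial j * t ^ ((i : ℕ) - j)) := by
    intro j t
    rw [← hReval, ← eval_iterate_derivative_sum, ← hRsum]
  have hcnorm : ‖c‖ ≤ C * (n * (r + 1) * (B * h ^ r)) := by
    refine (hmain c y hy).trans (mul_le_mul_of_nonneg_left ?_ hC.le)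
    calc _ ≤ ∑ _ν : Fin n, ∑ _j ∈ Finset.range (r + 1), B * h ^ r := by
          refine Finset.sum_le_sum fun ν _ => Finset.sum_le_sum fun j hj => ?_
          have hj' : j ≤ r := Nat.lt_succ_iff.mp (Finset.mem_range.mp hj)
          rw [← hexp, abs_mul, abs_of_pos (pow_pos hh j)]
          calc h ^ j * _ ≤ h ^ j * (B * h ^ (r - j)) := by gcongr; exact hdata ν j hj'
            _ = B * (h ^ j * h ^ (r - j)) := by ring
            _ = B * h ^ r := by rw [← pow_add, Nat.add_sub_cancel' hj']
      _ = n * (r + 1) * (B * h ^ r) := by simp [mul_assoc]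
  have hfin : h ^ r * |(Polynomial.derivative^[r] Q).eval (h * x + a)| ≤ ‖c‖ * D := by
    rw [← abs_of_pos (pow_pos hh r), ← abs_mul, hexp, hD, Finset.mul_sum]
    refine (Finset.abs_sum_le_sum_abs _ _).trans (Finset.sum_le_sum fun i _ => ?_)
    rw [abs_mul]
    refine mul_le_mul (norm_le_pi_norm c i) ?_ (abs_nonneg _) (norm_nonneg _)
    rw [abs_mul, Nat.abs_cast, abs_pow, abs_of_nonneg hx.1]
    exact mul_le_of_le_one_right (Nat.cast_nonneg _) (pow_le_one₀ hx.1 hx.2)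
  have hB : 0 ≤ B := by
    have hn : 0 < n := by
      by_contra hn0
      simp [show n = 0 by omega] at hdeg
    have := (abs_nonneg _).trans (hdata ⟨0, hn⟩ r le_rfl)
    simpa using this
  have hhr := pow_pos hh r
  have h3 : h ^ r * |(Polynomial.derivative^[r] Q).eval (h * x + a)| ≤
      h ^ r * (C * (n * (r + 1)) * D * B) := by
    refine hfin.trans ((mul_le_mul_of_nonneg_right hcnorm hD0).trans_eq (by ring))
  have h4 := le_of_mul_le_mul_left h3 hhr
  linarith

lemma Polynomial.exists_antiderivative (P : Polynomial ℝ) (a : ℝ) :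
    ∃ Q : Polynomial ℝ, Polynomial.derivative Q = P ∧ Q.natDegree ≤ P.natDegree + 1 ∧
      Q.eval a = 0 := by
  set R : Polynomial ℝ := ∑ i ∈ Finset.range (P.natDegree + 1),
    Polynomial.C (P.coeff i / (i + 1)) * Polynomial.X ^ (i + 1) with hR
  refine ⟨R - Polynomial.C (R.eval a), ?_, ?_, by simp⟩
  · rw [Polynomial.derivative_sub, Polynomial.derivative_C, sub_zero, hR,
      Polynomial.derivative_sum]
    conv_rhs => rw [P.as_sum_range_C_mul_X_pow]
    refine Finset.sum_congr rfl fun i _ => ?_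
    have hi : (i + 1 : ℝ) ≠ 0 := by positivity
    rw [Polynomial.derivative_C_mul_X_pow, Nat.add_sub_cancel]
    push_cast
    rw [div_mul_cancel₀ _ hi]
  · rw [Polynomial.natDegree_sub_C]
    refine Polynomial.natDegree_sum_le_of_forall_le _ _ fun i hi => ?_
    have := Finset.mem_range.mp hi
    exact (Polynomial.natDegree_C_mul_X_pow_le _ _).trans (by omega)

lemma Polynomial.exists_iterated_antiderivative (P : Polynomial ℝ) (a : ℝ) (r : ℕ) :
    ∃ Q : Polynomial ℝ, Polynomial.derivative^[r] Q = P ∧ Q.natDegree ≤ P.natDegree + r ∧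
      ∀ j < r, (Polynomial.derivative^[j] Q).eval a = 0 := by
  induction r generalizing P with
  | zero => exact ⟨P, rfl, le_rfl, by simp⟩
  | succ r ih =>
    obtain ⟨P₁, h1, h2, h3⟩ := P.exists_antiderivative a
    obtain ⟨Q, hQ1, hQ2, hQ3⟩ := ih P₁
    refine ⟨Q, by rw [Function.iterate_succ_apply', hQ1, h1], by omega, fun j hj => ?_⟩
    rcases Nat.lt_succ_iff_lt_or_eq.mp hj with h | rfl
    · exact hQ3 j h
    · rw [hQ1, h3]

/-- Iterated mean value estimate for a chain of derivatives vanishing at `c`. -/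
lemma abs_le_mul_pow_of_derivative_chain {r : ℕ} {φ : ℕ → ℝ → ℝ} {a b c ρ B : ℝ}
    (hφ : ∀ j < r, ∀ x ∈ Set.Icc a b, HasDerivWithinAt (φ j) (φ (j + 1) x) (Set.Icc a b) x)
    (hc : c ∈ Set.Icc a b) (hzero : ∀ j < r, φ j c = 0)
    (hB : ∀ x ∈ Set.Icc a b, |x - c| ≤ ρ → |φ r x| ≤ B) (i : ℕ) (hi : i ≤ r) :
    ∀ x ∈ Set.Icc a b, |x - c| ≤ ρ → |φ (r - i) x| ≤ B * ρ ^ i := by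
  induction i with
  | zero => simpa using hB
  | succ i ih =>
    intro x hx hxc
    have hρ : 0 ≤ ρ := (abs_nonneg _).trans hxc
    have hB0 : 0 ≤ B := (abs_nonneg _).trans (hB c hc (by simpa using hρ))
    set s : Set ℝ := Set.Icc a b ∩ Metric.closedBall c ρ with hs
    have hconv : Convex ℝ s := (convex_Icc a b).inter (convex_closedBall c ρ)
    have hidx : r - (i + 1) + 1 = r - i := by omega
    have h := hconv.norm_image_sub_le_of_norm_hasDerivWithin_le (f := φ (r - (i + 1)))
      (f' := φ (r - i)) (C := B * ρ ^ i)
      (fun y hy => by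
        have := hφ (r - (i + 1)) (by omega) y hy.1
        rw [hidx] at this
        exact this.mono Set.inter_subset_left)
      (fun y hy => ih (by omega) y hy.1 (by simpa [Real.dist_eq] using hy.2))
      (show c ∈ s from ⟨hc, Metric.mem_closedBall_self hρ⟩)
      (show x ∈ s from ⟨hx, by simpa [Real.dist_eq] using hxc⟩)
    rw [hzero _ (by omega), sub_zero, Real.norm_eq_abs, Real.norm_eq_abs] at h
    calc |φ (r - (i + 1)) x| ≤ B * ρ ^ i * |x - c| := h
      _ ≤ B * ρ ^ i * ρ := by gcongr
      _ = B * ρ ^ (i + 1) := by ring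

lemma add_mul_le_of_separated {μ : ℕ} {z : ℕ → ℝ} {d : ℝ} (hd : 0 ≤ d)
    (hz : ∀ j, j + 1 ≤ μ → d ≤ z (j + 1) - z j) {i j : ℕ} (hij : i < j) (hj : j ≤ μ) :
    z i + d ≤ z j := by
  induction j, hij using Nat.le_induction with
  | base => linarith [hz i hj]
  | succ j _ ih => linarith [ih (by omega), hz j hj]

lemma exists_bound_of_hermite_zeros (r μ : ℕ) (hμ : 1 ≤ μ) {lam : ℝ} (hlam : 0 < lam) :
    ∃ C : ℝ, 0 < C ∧ ∀ (z : ℕ → ℝ) (φ : ℕ → ℝ → ℝ), z 0 < z μ →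
      (∀ j, j + 1 ≤ μ → lam * (z μ - z 0) ≤ z (j + 1) - z j) →
      (∀ j < r, ∀ x ∈ Set.Icc (z 0) (z μ),
        HasDerivWithinAt (φ j) (φ (j + 1) x) (Set.Icc (z 0) (z μ)) x) →
      ContinuousOn (φ r) (Set.Icc (z 0) (z μ)) →
      (∀ ν ≤ μ, ∀ j ≤ r, φ j (z ν) = 0) →
      ∀ x ∈ Set.Icc (z 0) (z μ), |φ r x| ≤
        C * smoothOmega ((r + 1) * (μ + 1) - r) (φ r) (z μ - z 0) (z 0) (z μ) := by
  have hk : r + 2 ≤ (r + 1) * (μ + 1) := by nlinarith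
  obtain ⟨C₁, hC₁, hwhitney⟩ := exists_whitney ((r + 1) * (μ + 1) - r) (by omega)
  obtain ⟨C₂, hC₂, hpoly⟩ := exists_derivative_bound_of_hermite_data r (μ + 1) hlam
  refine ⟨C₁ + C₂ * C₁, by positivity, fun z φ hz hsep hφ hcont hzero x hx => ?_⟩
  have hh : 0 < z μ - z 0 := sub_pos.2 hz
  have hd : 0 ≤ lam * (z μ - z 0) := by positivity
  obtain ⟨P, hPdeg, hP⟩ := hwhitney (φ r) (z 0) (z μ) hz hcont
  set h := z μ - z 0 with hhdef
  set W := smoothOmega ((r + 1) * (μ + 1) - r) (φ r) h (z 0) (z μ)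
  obtain ⟨Q, hQP, hQdeg, hQzero⟩ := P.exists_iterated_antiderivative (z 0) r
  have hmem : ∀ ν ≤ μ, z ν ∈ Set.Icc (z 0) (z μ) := by
    intro ν hν
    constructor
    · rcases Nat.eq_zero_or_pos ν with rfl | h0
      · exact le_rfl
      · linarith [add_mul_le_of_separated hd hsep h0 hν]
    · rcases hν.eq_or_lt with rfl | h0
      · exact le_rfl
      · linarith [add_mul_le_of_separated hd hsep h0 le_rfl]
  have h0mem := hmem 0 (Nat.zero_le _)
  have htaylor := abs_le_mul_pow_of_derivative_chain (r := r) (a := z 0) (b := z μ) (c := z 0)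
    (ρ := h) (B := C₁ * W)
    (φ := fun j t => φ j t - (Polynomial.derivative^[j] Q).eval t)
    (fun j hj t ht => by
      have h1 := ((Polynomial.derivative^[j] Q).hasDerivAt t).hasDerivWithinAt
        (s := Set.Icc (z 0) (z μ))
      rw [← Function.iterate_succ_apply' (f := Polynomial.derivative)] at h1
      exact (hφ j hj t ht).sub h1)
    h0mem (fun j hj => by rw [hzero 0 (Nat.zero_le _) j hj.le, hQzero j hj, sub_zero])
    (fun t ht _ => by rw [hQP]; exact hP t ht)
  have hy : (fun ν : Fin (μ + 1) => (z ν - z 0) / h) ∈ separatedUnitKnots (μ + 1) lam := by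
    refine ⟨fun i => ?_, fun i j hij => ?_⟩
    · have := hmem i (by omega)
      refine ⟨div_nonneg (by linarith [this.1]) hh.le, ?_⟩
      rw [div_le_one hh]
      linarith [this.2]
    · rw [← sub_div, le_div_iff₀ hh]
      linarith [add_mul_le_of_separated hd hsep (show (i : ℕ) < j from hij) (by omega)]
  have hresc : ∀ t, h * ((t - z 0) / h) + z 0 = t := fun t => by
    rw [mul_div_cancel₀ _ hh.ne', sub_add_cancel]
  have hPbound := hpoly (z 0) h (C₁ * W) _ Q hh hy (by omega)
    (fun ν j hj => by
      have hν : (ν : ℕ) ≤ μ := by omega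
      have h1 := htaylor (r - j) (by omega) (z ν) (hmem ν hν) (by
        rw [abs_of_nonneg (by linarith [(hmem ν hν).1])]
        linarith [(hmem ν hν).2])
      rw [Nat.sub_sub_self hj, hzero ν hν j hj, zero_sub, abs_neg] at h1
      rwa [hresc])
    ((x - z 0) / h) ⟨div_nonneg (by linarith [hx.1]) hh.le, by
      rw [div_le_one hh]; linarith [hx.2]⟩
  rw [hresc, hQP] at hPbound
  have h1 := hP x hx
  have h2 := abs_add_le (φ r x - P.eval x) (P.eval x)
  rw [sub_add_cancel] at h2
  linarith

lemma exists_pointwise_bound_of_hermite_zeros (r μ : ℕ) (hμ : 1 ≤ μ) {lam : ℝ}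
    (hlam : 0 < lam) :
    ∃ C : ℝ, 0 < C ∧ ∀ (z : ℕ → ℝ) (φ : ℕ → ℝ → ℝ), z 0 < z μ →
      (∀ j, j + 1 ≤ μ → lam * (z μ - z 0) ≤ z (j + 1) - z j) →
      (∀ j < r, ∀ x ∈ Set.Icc (z 0) (z μ),
        HasDerivWithinAt (φ j) (φ (j + 1) x) (Set.Icc (z 0) (z μ)) x) →
      ContinuousOn (φ r) (Set.Icc (z 0) (z μ)) →
      (∀ ν ≤ μ, ∀ j ≤ r, φ j (z ν) = 0) →
      ∀ t ∈ Set.Icc (z 0) (z μ), ∀ ν ≤ μ, z ν ∈ Set.Icc (z 0) (z μ) →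
        |φ 0 t| ≤ C * |t - z ν| ^ (r + 1) *
          ∫ s in Set.Ioc |t - z ν| (2 * (z μ - z 0)),
            smoothOmega ((r + 1) * (μ + 1) - r) (φ r) s (z 0) (z μ) / s ^ 2 := by
  have hk : r + 2 ≤ (r + 1) * (μ + 1) := by nlinarith
  obtain ⟨C₁, hC₁, hbound⟩ := exists_bound_of_hermite_zeros r μ hμ hlam
  obtain ⟨C₂, hC₂, hmarchaud⟩ := exists_marchaud ((r + 1) * (μ + 1) - r) (by omega)
  refine ⟨C₂ * (1 + 4 * C₁), by positivity, fun z φ hz hsep hφ hcont hzero t ht ν hν hzν => ?_⟩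
  have hh : 0 < z μ - z 0 := sub_pos.2 hz
  have hM := hbound z φ hz hsep hφ hcont hzero
  set h := z μ - z 0 with hhdef
  set k := (r + 1) * (μ + 1) - r
  set W := smoothOmega k (φ r) h (z 0) (z μ) with hW
  have hW0 : 0 ≤ W := smoothOmega_nonneg _ _ _ _ _
  set δ := |t - z ν| with hδ
  set J := ∫ s in Set.Ioc δ (2 * h), smoothOmega k (φ r) s (z 0) (z μ) / s ^ 2 with hJ
  rcases eq_or_lt_of_le (show 0 ≤ δ from abs_nonneg _) with h0 | hδ0
  · have htz : t = z ν := sub_eq_zero.1 (abs_eq_zero.1 h0.symm)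
    rw [← h0, htz, hzero ν hν 0 (Nat.zero_le _)]
    simp
  have hδh : δ ≤ h := by
    rw [hδ, abs_le]
    constructor <;> linarith [ht.1, ht.2, hzν.1, hzν.2]
  have hWJ : W / h ≤ 4 * J := by
    rw [div_le_iff₀ hh]
    refine (smoothOmega_le_integral hM hh).trans ?_
    have : (∫ s in Set.Ioc h (2 * h), smoothOmega k (φ r) s (z 0) (z μ) / s ^ 2) ≤ J :=
      MeasureTheory.setIntegral_mono_set (integrableOn_smoothOmega_div_sq hM hδ0)
        (Filter.Eventually.of_forall fun s =>
          div_nonneg (smoothOmega_nonneg _ _ _ _ _) (sq_nonneg s))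
        (Set.Ioc_subset_Ioc_left hδh).eventuallyLE
    calc _ ≤ 4 * h * J := by gcongr
      _ = 4 * J * h := by ring
  have hω := hmarchaud (φ r) (z 0) (z μ) (C₁ * W) δ hz (by positivity) hM hδ0
  have hG : ∀ x ∈ Set.Icc (z 0) (z μ), |x - z ν| ≤ δ →
      |φ r x| ≤ smoothOmega 1 (φ r) δ (z 0) (z μ) := by
    intro x hx hxδ
    rcases eq_or_ne x (z ν) with rfl | hne
    · rw [hzero ν hν r le_rfl, abs_zero]
      exact smoothOmega_nonneg _ _ _ _ _
    · have := abs_fwdDiff_iter_le_smoothOmega (k := 1) hM (sub_ne_zero.2 hne) hxδ hzν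
        (by simpa using hx)
      simpa [fwdDiff, hzero ν hν r le_rfl] using this
  have hmain := abs_le_mul_pow_of_derivative_chain hφ hzν (fun j hj => hzero ν hν j hj.le) hG r
    le_rfl t ht le_rfl
  rw [Nat.sub_self] at hmain
  refine hmain.trans ?_
  calc _ ≤ C₂ * δ * (J + C₁ * W / h) * δ ^ r := by gcongr
    _ ≤ C₂ * δ * (J + C₁ * (4 * J)) * δ ^ r := by
        rw [mul_div_assoc]
        gcongr
    _ = C₂ * (1 + 4 * C₁) * δ ^ (r + 1) * J := by ring

/-- pointwise estimate for Hermite interpolation with full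
multiplicity `r+1` at separated knots. -/
theorem stmt18 (r μ : ℕ) (hμ : 1 ≤ μ) (lam : ℝ) (hlam0 : 0 < lam) (hlam1 : lam ≤ 1) :
    ∃ C : ℝ, 0 < C ∧ ∀ z : ℕ → ℝ,
      (∀ j : ℕ, j + 1 ≤ μ → z j < z (j + 1)) →
      (∀ j : ℕ, j + 1 ≤ μ → lam * (z μ - z 0) ≤ z (j + 1) - z j) →
      ∀ f : ℝ → ℝ, ContDiffOn ℝ r f (Set.Icc (z 0) (z μ)) →
      ∀ L : Polynomial ℝ, L.natDegree ≤ (r + 1) * (μ + 1) - 1 →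
      (∀ ν : ℕ, ν ≤ μ → ∀ j : ℕ, j ≤ r →
        (Polynomial.derivative^[j] L).eval (z ν) =
          iteratedDerivWithin j f (Set.Icc (z 0) (z μ)) (z ν)) →
      ∀ t ∈ Set.Icc (z 0) (z μ),
        |f t - L.eval t| ≤
          C * (sInf {v : ℝ | ∃ ν : ℕ, ν ≤ μ ∧ v = |t - z ν|}) ^ (r + 1) *
            ∫ s in Set.Ioc (sInf {v : ℝ | ∃ ν : ℕ, ν ≤ μ ∧ v = |t - z ν|})
                (2 * (z μ - z 0)),
              smoothOmega ((r + 1) * (μ + 1) - r)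
                (iteratedDerivWithin r f (Set.Icc (z 0) (z μ))) s (z 0) (z μ) / s ^ 2 := by
  obtain ⟨C, hC, hmain⟩ := exists_pointwise_bound_of_hermite_zeros r μ hμ hlam0
  refine ⟨C, hC, fun z hmono hsep f hf L hdeg hL t ht => ?_⟩
  have hlt : ∀ ν, ν ≤ μ → ∀ i < ν, z i < z ν := by
    intro ν
    induction ν with
    | zero => intro _ i hi; omega
    | succ ν ih =>
      intro hν i hi
      rcases Nat.lt_succ_iff_lt_or_eq.mp hi with h | rfl
      · exact (ih (by omega) i h).trans (hmono ν hν)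
      · exact hmono i hν
  have hz : z 0 < z μ := hlt μ le_rfl 0 (by omega)
  have hmem : ∀ ν ≤ μ, z ν ∈ Set.Icc (z 0) (z μ) := by
    intro ν hν
    constructor
    · rcases Nat.eq_zero_or_pos ν with rfl | h0
      · exact le_rfl
      · exact (hlt ν hν 0 h0).le
    · rcases hν.eq_or_lt with rfl | h0
      · exact le_rfl
      · exact (hlt μ le_rfl ν h0).le
  set I := Set.Icc (z 0) (z μ) with hI
  have hud : UniqueDiffOn ℝ I := uniqueDiffOn_Icc hz
  set δ := sInf {v : ℝ | ∃ ν : ℕ, ν ≤ μ ∧ v = |t - z ν|} with hδ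
  obtain ⟨ν, hν, hδν⟩ : δ ∈ {v : ℝ | ∃ ν : ℕ, ν ≤ μ ∧ v = |t - z ν|} := by
    refine Set.Nonempty.csInf_mem ⟨_, 0, Nat.zero_le _, rfl⟩ ?_
    refine ((Set.finite_Iic μ).image fun ν => |t - z ν|).subset ?_
    rintro v ⟨ν, hν, rfl⟩
    exact ⟨ν, hν, rfl⟩
  have hLr : (Polynomial.derivative^[r] L).natDegree < (r + 1) * (μ + 1) - r := by
    have h1 := Polynomial.natDegree_iterate_derivative L r
    have h2 : r + 2 ≤ (r + 1) * (μ + 1) := by nlinarith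
    omega
  have hfinal := hmain z
    (fun j x => iteratedDerivWithin j f I x - (Polynomial.derivative^[j] L).eval x) hz hsep
    (fun j hj x hx => by
      have h1 := ((Polynomial.derivative^[j] L).hasDerivAt x).hasDerivWithinAt (s := I)
      rw [← Function.iterate_succ_apply' (f := Polynomial.derivative)] at h1
      have h2 := (hf.differentiableOn_iteratedDerivWithin (m := j) (by exact_mod_cast hj) hud
        x hx).hasDerivWithinAt
      rw [← iteratedDerivWithin_succ] at h2
      exact h2.sub h1)
    ((hf.continuousOn_iteratedDerivWithin le_rfl hud).sub
      (Polynomial.derivative^[r] L).continuous.continuousOn)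
    (fun ν hν j hj => by rw [hL ν hν j hj, sub_self]) t ht ν hν (hmem ν hν)
  rw [← hδν] at hfinal
  simp only [smoothOmega_sub_polynomial _ _ hLr, iteratedDerivWithin_zero,
    Function.iterate_zero, id] at hfinal
  exact hfinal
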